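/- arXiv:2005.00933 — 10 statements merged into one kernel-verified Lean document; each statement's English description precedes it below -/
import Mathlib

section
/- Let M be a T0 sober topological space. Given m, n ∈ M, call an element s ∈ M a disjunction of m and n if: (i) every open set containing m contains s; (ii) every open set containing n contains s; (iii) for every open set U containing s there exist open sets V and W with m ∈ V, n ∈ W and V ∩ W ⊆ U. Then the following are equivalent: (1) every pair m, n ∈ M has a disjunction; (2) every pair m, n ∈ M has a join m ∨ n in the specialization order of M and the binary join map ∨ : M × M → M is continuous for the product topology. Moreover, when these equivalent conditions hold, the disjunction of any pair m, n is unique and coincides with the join m ∨ n. -/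
/-- The specialization order on a topological space: `specLe x y` means every open set
containing `x` contains `y`, i.e. `x ∈ closure {y}`. -/
def specLe {X : Type*} [TopologicalSpace X] (x y : X) : Prop :=
  ∀ U : Set X, IsOpen U → x ∈ U → y ∈ U

/-- `s` is a disjunction of `m` and `n`. -/
def IsDisjunction {M : Type*} [TopologicalSpace M] (m n s : M) : Prop :=
  (∀ U : Set M, IsOpen U → m ∈ U → s ∈ U) ∧
  (∀ U : Set M, IsOpen U → n ∈ U → s ∈ U) ∧
  (∀ U : Set M, IsOpen U → s ∈ U →
    ∃ V W : Set M, IsOpen V ∧ IsOpen W ∧ m ∈ V ∧ n ∈ W ∧ V ∩ W ⊆ U)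

/-- `j` is the join of `m` and `n` in the specialization order. -/
def IsSpecJoin {M : Type*} [TopologicalSpace M] (m n j : M) : Prop :=
  specLe m j ∧ specLe n j ∧ ∀ u : M, specLe m u → specLe n u → specLe j u

theorem specLe_antisymm {X : Type*} [TopologicalSpace X] [T0Space X] {x y : X}
    (hxy : specLe x y) (hyx : specLe y x) : x = y :=
  (inseparable_iff_forall_isOpen.2 fun U hU => ⟨hxy U hU, hyx U hU⟩).eq

theorem IsSpecJoin.unique {X : Type*} [TopologicalSpace X] [T0Space X] {m n j k : X}
    (hj : IsSpecJoin m n j) (hk : IsSpecJoin m n k) : j = k :=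
  specLe_antisymm (hj.2.2 k hk.1 hk.2.1) (hk.2.2 j hj.1 hj.2.1)

theorem IsDisjunction.isSpecJoin {X : Type*} [TopologicalSpace X] {m n s : X}
    (h : IsDisjunction m n s) : IsSpecJoin m n s := by
  refine ⟨h.1, h.2.1, fun u hmu hnu U hU hs => ?_⟩
  obtain ⟨V, W, hV, hW, hm, hn, hVW⟩ := h.2.2 U hU hs
  exact hVW ⟨hmu V hV hm, hnu W hW hn⟩

theorem continuous_of_isDisjunction {X : Type*} [TopologicalSpace X] {f : X → X → X}
    (hf : ∀ m n, IsDisjunction m n (f m n)) : Continuous (fun p : X × X => f p.1 p.2) := by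
  refine continuous_def.2 fun U hU => isOpen_prod_iff.2 fun m n hmn => ?_
  obtain ⟨V, W, hV, hW, hm, hn, hVW⟩ := (hf m n).2.2 U hU hmn
  exact ⟨V, W, hV, hW, hm, hn, fun p hp =>
    hVW ⟨(hf p.1 p.2).1 V hV hp.1, (hf p.1 p.2).2.1 W hW hp.2⟩⟩

theorem isDisjunction_of_continuous {X : Type*} [TopologicalSpace X] {f : X → X → X}
    (hf : ∀ m n, IsSpecJoin m n (f m n)) (hc : Continuous (fun p : X × X => f p.1 p.2))
    (m n : X) : IsDisjunction m n (f m n) := by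
  refine ⟨(hf m n).1, (hf m n).2.1, fun U hU hs => ?_⟩
  obtain ⟨V, W, hV, hW, hm, hn, hVW⟩ := isOpen_prod_iff.1 (hU.preimage hc) m n hs
  refine ⟨V, W, hV, hW, hm, hn, fun x hx => ?_⟩
  have hxx : f x x ∈ U := hVW (Set.mk_mem_prod hx.1 hx.2)
  exact (hf x x).2.2 x (fun _ _ h => h) (fun _ _ h => h) U hU hxx

theorem stmt0 {M : Type*} [TopologicalSpace M] [T0Space M] [QuasiSober M] :
    ((∀ m n : M, ∃ s : M, IsDisjunction m n s) ↔
      ∃ join : M → M → M, (∀ m n : M, IsSpecJoin m n (join m n)) ∧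
        Continuous (fun p : M × M => join p.1 p.2)) ∧
    (∀ m n s : M, IsDisjunction m n s →
      IsSpecJoin m n s ∧ ∀ s' : M, IsDisjunction m n s' → s' = s) := by
  refine ⟨⟨fun h => ?_, fun ⟨f, hf, hc⟩ m n => ⟨f m n, isDisjunction_of_continuous hf hc m n⟩⟩,
    fun m n s hs => ⟨hs.isSpecJoin, fun s' hs' => hs'.isSpecJoin.unique hs.isSpecJoin⟩⟩
  choose f hf using h
  exact ⟨f, fun m n => (hf m n).isSpecJoin, continuous_of_isDisjunction hf⟩
end

section
/- The specialization order of any sober lattice L is a complete lattice: every subset S ⊆ L has a supremum ⋁S in the specialization order. -/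
/-- The data and axioms making a (T0, sober) topological space into a sober lattice:
a least element and continuous binary joins for the specialization order. -/
structure SoberLatticeStruct (L : Type*) [TopologicalSpace L] where
  bot : L
  join : L → L → L
  bot_le : ∀ x : L, specLe bot x
  le_join_left : ∀ x y : L, specLe x (join x y)
  le_join_right : ∀ x y : L, specLe y (join x y)
  join_le : ∀ x y u : L, specLe x u → specLe y u → specLe (join x y) u
  continuous_join : Continuous (fun p : L × L => join p.1 p.2)

/-- `j` is the supremum of the set `S` in the specialization order. -/
def IsSpecLUB {X : Type*} [TopologicalSpace X] (S : Set X) (j : X) : Prop :=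
  (∀ s ∈ S, specLe s j) ∧ ∀ u : X, (∀ s ∈ S, specLe s u) → specLe j u

theorem specLe_iff_specializes {X : Type*} [TopologicalSpace X] {x y : X} :
    specLe x y ↔ y ⤳ x :=
  specializes_iff_forall_open.symm

/-- A nonempty set that is directed for the specialization order is irreducible. -/
theorem isIrreducible_of_directed_specLe {X : Type*} [TopologicalSpace X] {T : Set X}
    (hne : T.Nonempty) (hT : DirectedOn specLe T) : IsIrreducible T := by
  refine ⟨hne, ?_⟩
  rintro U V hU hV ⟨x, hxT, hxU⟩ ⟨y, hyT, hyV⟩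
  obtain ⟨z, hzT, hxz, hyz⟩ := hT x hxT y hyT
  exact ⟨z, hzT, hxz U hU hxU, hyz V hV hyV⟩

/-- In a quasi-sober space, nonempty directed sets have suprema in the specialization order. -/
theorem exists_isSpecLUB_of_directed {X : Type*} [TopologicalSpace X] [QuasiSober X] {T : Set X}
    (hne : T.Nonempty) (hT : DirectedOn specLe T) : ∃ j : X, IsSpecLUB T j := by
  have hirr := isIrreducible_of_directed_specLe hne hT
  have hgen := hirr.isGenericPoint_genericPoint_closure
  refine ⟨hirr.genericPoint, fun s hs => ?_, fun u hu => ?_⟩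
  · exact specLe_iff_specializes.2 (hgen.specializes (subset_closure hs))
  · rw [specLe_iff_specializes, specializes_iff_mem_closure]
    exact closure_minimal
      (fun s hs => (specLe_iff_specializes.1 (hu s hs)).mem_closure) isClosed_closure hgen.mem

/-- Membership in the set of finite joins of elements of `S`. -/
inductive SoberLatticeStruct.IsFiniteJoin {L : Type*} [TopologicalSpace L]
    (SL : SoberLatticeStruct L) (S : Set L) : L → Prop
  | bot : SL.IsFiniteJoin S SL.bot
  | mem {s : L} (hs : s ∈ S) : SL.IsFiniteJoin S s
  | join {x y : L} (hx : SL.IsFiniteJoin S x) (hy : SL.IsFiniteJoin S y) :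
      SL.IsFiniteJoin S (SL.join x y)

theorem SoberLatticeStruct.IsFiniteJoin.specLe_of_forall_mem {L : Type*} [TopologicalSpace L]
    {SL : SoberLatticeStruct L} {S : Set L} {x u : L} (hx : SL.IsFiniteJoin S x)
    (hu : ∀ s ∈ S, specLe s u) : specLe x u := by
  induction hx with
  | bot => exact SL.bot_le u
  | mem hs => exact hu _ hs
  | join _ _ ihx ihy => exact SL.join_le _ _ _ ihx ihy

theorem stmt2 {L : Type*} [TopologicalSpace L] [T0Space L] [QuasiSober L]
    (SL : SoberLatticeStruct L) :
    ∀ S : Set L, ∃ j : L, IsSpecLUB S j := by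
  intro S
  obtain ⟨j, hj, hmin⟩ := exists_isSpecLUB_of_directed (T := {x | SL.IsFiniteJoin S x})
    ⟨SL.bot, .bot⟩
    fun x hx y hy => ⟨SL.join x y, .join hx hy, SL.le_join_left x y, SL.le_join_right x y⟩
  exact ⟨j, fun s hs => hj s (.mem hs),
    fun u hu => hmin u fun _ hx => hx.specLe_of_forall_mem hu⟩
end

section
/- Let L be a sober lattice and J any set. The join operation ⋁ : L^J → L, sending a family (x_j)_{j∈J} to its supremum ⋁_{j∈J} x_j in the specialization order, is continuous with respect to the product topology on L^J. -/
theorem specLe_of_mem_closure {X : Type*} [TopologicalSpace X] {x y : X} (h : x ∈ closure {y}) :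
    specLe x y := by
  intro U hU hx
  obtain ⟨z, hzU, rfl⟩ := mem_closure_iff.1 h U hU hx
  exact hzU

/-- Open subsets of a quasi-sober space are inaccessible by directed suprema. -/
theorem exists_mem_of_isSpecLUB_range {X ι : Type*} [TopologicalSpace X] [QuasiSober X]
    [Nonempty ι] {d : ι → X} (hd : ∀ i j, ∃ k, specLe (d i) (d k) ∧ specLe (d j) (d k))
    {s : X} (hs : IsSpecLUB (Set.range d) s) {U : Set X} (hU : IsOpen U) (hsU : s ∈ U) :
    ∃ i, d i ∈ U := by
  have hirr : IsIrreducible (Set.range d) := by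
    refine ⟨Set.range_nonempty d, ?_⟩
    rintro V W hV hW ⟨_, ⟨i, rfl⟩, hi⟩ ⟨_, ⟨j, rfl⟩, hj⟩
    obtain ⟨k, hik, hjk⟩ := hd i j
    exact ⟨d k, ⟨k, rfl⟩, hik V hV hi, hjk W hW hj⟩
  obtain ⟨g, hg⟩ := QuasiSober.sober hirr.closure isClosed_closure
  have hsg : specLe s g := hs.2 g fun t ht => specLe_of_mem_closure <| by
    rw [hg.def]
    exact subset_closure ht
  have hgD : g ∈ closure (Set.range d) := hg.mem
  obtain ⟨_, hdU, i, rfl⟩ := mem_closure_iff.1 hgD U hU (hsg U hU hsU)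
  exact ⟨i, hdU⟩

theorem SoberLatticeStruct.exists_continuous_finset_sup {L J : Type*} [TopologicalSpace L]
    (SL : SoberLatticeStruct L) (F : Finset J) :
    ∃ f : (J → L) → L, Continuous f ∧ ∀ x, IsSpecLUB (x '' F) (f x) := by
  classical
  induction F using Finset.induction_on with
  | empty => exact ⟨fun _ => SL.bot, continuous_const, fun x => ⟨by simp, fun u _ => SL.bot_le u⟩⟩
  | insert a F _ ih =>
    obtain ⟨f, hf, hlub⟩ := ih
    refine ⟨fun x => SL.join (x a) (f x),
      SL.continuous_join.comp ((continuous_apply a).prodMk hf), fun x => ⟨?_, fun u hu => ?_⟩⟩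
    · rintro _ ⟨j, hj, rfl⟩
      rcases Finset.mem_insert.1 hj with rfl | hj
      · exact SL.le_join_left _ _
      · exact fun U hU h => SL.le_join_right _ _ U hU ((hlub x).1 _ ⟨j, hj, rfl⟩ U hU h)
    · refine SL.join_le _ _ _ (hu _ ⟨a, by simp, rfl⟩) ((hlub x).2 u ?_)
      rintro _ ⟨j, hj, rfl⟩
      exact hu _ ⟨j, Finset.mem_insert_of_mem hj, rfl⟩

theorem stmt3 {L : Type*} (J : Type*) [TopologicalSpace L] [T0Space L] [QuasiSober L]
    (SL : SoberLatticeStruct L) (sup : (J → L) → L)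
    (hsup : ∀ x : J → L, IsSpecLUB (Set.range x) (sup x)) :
    Continuous sup := by
  classical
  choose f hf hlub using SL.exists_continuous_finset_sup (J := J)
  have hmono : ∀ x F G, F ⊆ G → specLe (f F x) (f G x) := fun x F G hFG =>
    (hlub F x).2 _ fun _ ⟨j, hj, hjs⟩ => (hlub G x).1 _ ⟨j, hFG hj, hjs⟩
  have hle : ∀ x F, specLe (f F x) (sup x) := fun x F =>
    (hlub F x).2 _ fun _ ⟨j, _, hjs⟩ => (hsup x).1 _ ⟨j, hjs⟩
  refine ⟨fun U hU => isOpen_iff_mem_nhds.2 fun x hx => ?_⟩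
  have hdir : IsSpecLUB (Set.range fun F => f F x) (sup x) := by
    refine ⟨?_, fun u hu => (hsup x).2 u ?_⟩
    · rintro _ ⟨F, rfl⟩
      exact hle x F
    · rintro _ ⟨j, rfl⟩ V hV h
      exact hu _ ⟨{j}, rfl⟩ V hV ((hlub {j} x).1 _ ⟨j, by simp, rfl⟩ V hV h)
  obtain ⟨F, hF⟩ := exists_mem_of_isSpecLUB_range
    (fun F G => ⟨F ∪ G, hmono x _ _ Finset.subset_union_left,
      hmono x _ _ Finset.subset_union_right⟩) hdir hU hx
  exact Filter.mem_of_superset ((hU.preimage (hf F)).mem_nhds hF) fun y hy => hle y F U hU hy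
end

section
/- Let f : L → M be a homomorphism of sober lattices, i.e. a continuous map with f(x ∨ y) = f(x) ∨ f(y) for all x, y ∈ L and f(0) = 0. Then f preserves arbitrary joins: for every subset S ⊆ L, f(⋁S) = ⋁{f(s) : s ∈ S}. -/
/-- A nonempty set that is directed for the specialization order is irreducible. -/
theorem isIrreducible_of_directed {X : Type*} [TopologicalSpace X] {D : Set X}
    (hne : D.Nonempty) (hdir : ∀ x ∈ D, ∀ y ∈ D, ∃ z ∈ D, specLe x z ∧ specLe y z) :
    IsIrreducible D := by
  refine ⟨hne, ?_⟩
  rintro U V hU hV ⟨x, hxD, hxU⟩ ⟨y, hyD, hyV⟩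
  obtain ⟨z, hzD, hxz, hyz⟩ := hdir x hxD y hyD
  exact ⟨z, hzD, hxz U hU hxU, hyz V hV hyV⟩

theorem stmt4 {L M : Type*} [TopologicalSpace L] [TopologicalSpace M]
    [T0Space L] [T0Space M] [QuasiSober L] [QuasiSober M]
    (SL : SoberLatticeStruct L) (SM : SoberLatticeStruct M)
    (f : L → M) (hcont : Continuous f)
    (hjoin : ∀ x y : L, f (SL.join x y) = SM.join (f x) (f y))
    (hbot : f SL.bot = SM.bot) :
    ∀ (S : Set L) (j : L) (j' : M), IsSpecLUB S j → IsSpecLUB (f '' S) j' → f j = j' := by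
  intro S j j' hj hj'
  have hmono {x y : L} (h : specLe x y) : specLe (f x) (f y) :=
    fun U hU hx => h (f ⁻¹' U) (hU.preimage hcont) hx
  -- The closed set of points whose image lies below `j'` is directed; its generic point bounds `S`.
  let D : Set L := f ⁻¹' closure {j'}
  have memD (x : L) : x ∈ D ↔ specLe (f x) j' := by
    rw [specLe_iff_specializes, specializes_iff_mem_closure, Set.mem_preimage]
  have hirr : IsIrreducible D := by
    refine isIrreducible_of_directed ⟨SL.bot, ?_⟩ fun x hx y hy =>
      ⟨SL.join x y, ?_, SL.le_join_left x y, SL.le_join_right x y⟩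
    · rw [memD, hbot]
      exact SM.bot_le j'
    · rw [memD, hjoin]
      exact SM.join_le _ _ _ ((memD x).1 hx) ((memD y).1 hy)
  obtain ⟨p, hp⟩ := QuasiSober.sober hirr (isClosed_closure.preimage hcont)
  have hjp : specLe j p := hj.2 p fun s hs =>
    specLe_iff_specializes.2 (hp.specializes ((memD s).2 (hj'.1 _ ⟨s, hs, rfl⟩)))
  have hle : specLe (f j) j' := fun U hU h => (memD p).1 hp.mem U hU (hmono hjp U hU h)
  have hge : specLe j' (f j) := hj'.2 _ (by rintro _ ⟨s, hs, rfl⟩; exact hmono (hj.1 s hs))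
  exact (specLe_iff_specializes.1 hge).antisymm (specLe_iff_specializes.1 hle) |>.eq
end

section
/- Let X be a second-countable locally compact sober topological space. Then the lattice O(X) of open subsets of X, equipped with the Scott topology, is a separable topological space: if B is a countable basis of X, then the (countable) set of finite unions of members of B is dense in O(X) with the Scott topology. -/
open TopologicalSpace

/-- The Scott topology on the complete lattice of open sets of `X`. -/
def scottTopOnOpens (X : Type*) [TopologicalSpace X] : TopologicalSpace (Opens X) :=
  Topology.scott (Opens X) Set.univ

/-- The open sets that are finite unions of members of `B`. -/
def finiteUnionOpens {X : Type*} [TopologicalSpace X] (B : Set (Set X)) : Set (Opens X) :=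
  {U : Opens X | ∃ F : Finset (Set X), (F : Set (Set X)) ⊆ B ∧
    (U : Set X) = ⋃₀ (F : Set (Set X))}

theorem countable_finiteUnionOpens {X : Type*} [TopologicalSpace X] {B : Set (Set X)}
    (hB : B.Countable) : (finiteUnionOpens B).Countable := by
  refine Set.MapsTo.countable_of_injOn (f := fun U : Opens X => (U : Set X)) ?_
    SetLike.coe_injective.injOn ((Set.countable_ofPred_finite_subset hB).image Set.sUnion)
  rintro U ⟨F, hF, hU⟩
  exact ⟨F, ⟨F.finite_toSet, hF⟩, hU.symm⟩

theorem directedOn_finiteUnionOpens_inter_Iic {X : Type*} [TopologicalSpace X]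
    (B : Set (Set X)) (U : Opens X) :
    DirectedOn (· ≤ ·) (finiteUnionOpens B ∩ Set.Iic U) := by
  classical
  rintro V ⟨⟨F, hF, hV⟩, hVU⟩ W ⟨⟨G, hG, hW⟩, hWU⟩
  refine ⟨V ⊔ W, ⟨⟨F ∪ G, ?_, ?_⟩, Set.mem_Iic.2 (sup_le hVU hWU)⟩, le_sup_left, le_sup_right⟩
  · rw [Finset.coe_union]
    exact Set.union_subset hF hG
  · rw [Opens.coe_sup, hV, hW, Finset.coe_union, Set.sUnion_union]

theorem isLUB_finiteUnionOpens_inter_Iic {X : Type*} [TopologicalSpace X]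
    {B : Set (Set X)} (hB : IsTopologicalBasis B) (U : Opens X) :
    IsLUB (finiteUnionOpens B ∩ Set.Iic U) U := by
  refine ⟨fun V hV => hV.2, fun W hW x hx => ?_⟩
  obtain ⟨b, hb, hxb, hbU⟩ := hB.exists_subset_of_mem_open hx U.isOpen
  have hmem : (⟨b, hB.isOpen hb⟩ : Opens X) ∈ finiteUnionOpens B ∩ Set.Iic U :=
    ⟨⟨{b}, by simpa using hb, by simp⟩, hbU⟩
  exact hW hmem hxb

theorem dense_finiteUnionOpens {X : Type*} [TopologicalSpace X] {B : Set (Set X)}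
    (hB : IsTopologicalBasis B) :
    @Dense (Opens X) (scottTopOnOpens X) (finiteUnionOpens B) := by
  let _ : TopologicalSpace (Opens X) := scottTopOnOpens X
  have : Topology.IsScott (Opens X) Set.univ := ⟨rfl⟩
  refine dense_iff_inter_open.2 fun 𝒰 h𝒰 ⟨U, hU⟩ => ?_
  have hinacc :=
    ((Topology.IsScott.isOpen_iff_isUpperSet_and_dirSupInaccOn (D := Set.univ)).1 h𝒰).2
  have hbot : (⊥ : Opens X) ∈ finiteUnionOpens B ∩ Set.Iic U :=
    ⟨⟨∅, by simp, by simp⟩, Set.mem_Iic.2 bot_le⟩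
  obtain ⟨V, hV, hV𝒰⟩ := hinacc (Set.mem_univ _) ⟨⊥, hbot⟩
    (directedOn_finiteUnionOpens_inter_Iic B U) (isLUB_finiteUnionOpens_inter_Iic hB U) hU
  exact ⟨V, hV𝒰, hV.1⟩

theorem stmt12 (X : Type*) [TopologicalSpace X] [SecondCountableTopology X]
    [LocallyCompactSpace X] [T0Space X] [QuasiSober X] :
    @SeparableSpace (Opens X) (scottTopOnOpens X) ∧
    ∀ B : Set (Set X), B.Countable → IsTopologicalBasis B →
      Set.Countable {U : Opens X | ∃ F : Finset (Set X), (F : Set (Set X)) ⊆ B ∧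
          (U : Set X) = ⋃₀ (F : Set (Set X))} ∧
      @Dense (Opens X) (scottTopOnOpens X)
        {U : Opens X | ∃ F : Finset (Set X), (F : Set (Set X)) ⊆ B ∧
          (U : Set X) = ⋃₀ (F : Set (Set X))} := by
  refine ⟨?_, fun B hBc hB => ⟨countable_finiteUnionOpens hBc, dense_finiteUnionOpens hB⟩⟩
  exact @SeparableSpace.mk (Opens X) (scottTopOnOpens X)
    ⟨finiteUnionOpens (countableBasis X), countable_finiteUnionOpens (countable_countableBasis X),
      dense_finiteUnionOpens (isBasis_countableBasis X)⟩
end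

section
/- Let X be a sober topological space whose specialization order is a complete lattice (every subset of X has a supremum in the specialization order). If Y ⊆ X is a subspace which is closed under the formation of arbitrary suprema (for every S ⊆ Y, the supremum of S computed in X belongs to Y), then Y, with the subspace topology, is a sober space. -/
theorem stmt13 {X : Type*} [TopologicalSpace X] [T0Space X] [QuasiSober X]
    (hsup : ∀ S : Set X, ∃ j : X, IsSpecLUB S j)
    (Y : Set X)
    (hY : ∀ S : Set X, S ⊆ Y → ∀ j : X, IsSpecLUB S j → j ∈ Y) :
    T0Space Y ∧ QuasiSober Y := by
  refine ⟨inferInstance, ⟨fun {C} hC hCclosed => ?_⟩⟩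
  obtain ⟨x, hx⟩ := QuasiSober.sober
    (hC.image Subtype.val continuous_subtype_val.continuousOn).closure isClosed_closure
  obtain ⟨j, hub, hleast⟩ := hsup (Subtype.val '' C)
  have hjY : j ∈ Y := hY _ (Subtype.coe_image_subset Y C) j ⟨hub, hleast⟩
  have hjx : x ⤳ j := specLe_iff_specializes.1 <| hleast x fun s hs =>
    specLe_iff_specializes.2 (hx.specializes (subset_closure hs))
  have hjC : (⟨j, hjY⟩ : Y) ∈ C := by
    rw [← hCclosed.closure_eq, closure_subtype, ← hx.def]
    exact hjx.mem_closure
  refine ⟨⟨j, hjY⟩, subset_antisymm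
    (hCclosed.closure_subset_iff.2 (Set.singleton_subset_iff.2 hjC)) fun c hc => ?_⟩
  rw [closure_subtype, Set.image_singleton]
  exact (specLe_iff_specializes.1 (hub c ⟨c, hc, rfl⟩)).mem_closure
end

section
/- Let A be a C*-algebra. The multiplication on Max A, defined for closed linear subspaces P, Q of A by PQ = closure of the linear span of the pointwise product {ab : a ∈ P, b ∈ Q}, is continuous as a map Max A × Max A → Max A, where Max A carries the lower Vietoris topology and Max A × Max A the product topology. -/
open Pointwise

/-- `MaxA A` is the set of closed linear subspaces of `A`. -/
def MaxA (A : Type*) [AddCommGroup A] [Module ℂ A] [TopologicalSpace A] :=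
  {P : Submodule ℂ A // IsClosed (P : Set A)}

/-- The lower Vietoris topology on `MaxA A`. -/
instance MaxA.instTopologicalSpace (A : Type*) [AddCommGroup A] [Module ℂ A]
    [TopologicalSpace A] : TopologicalSpace (MaxA A) :=
  TopologicalSpace.generateFrom
    {V : Set (MaxA A) | ∃ U : Set A, IsOpen U ∧
      V = {P : MaxA A | (((P.1 : Submodule ℂ A) : Set A) ∩ U).Nonempty}}

/-- The multiplication on `MaxA A` for a C*-algebra `A`: `PQ` is the closure of the
linear span of the set of pointwise products `{a * b : a ∈ P, b ∈ Q}`. -/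
noncomputable def maxMul {A : Type*} [NonUnitalCStarAlgebra A] (P Q : MaxA A) : MaxA A :=
  ⟨(Submodule.span ℂ
      (((P.1 : Submodule ℂ A) : Set A) * ((Q.1 : Submodule ℂ A) : Set A))).topologicalClosure,
    Submodule.isClosed_topologicalClosure _⟩

open Topology Filter in
lemma MaxA.eventually_inter_nonempty {A : Type*} [AddCommGroup A] [Module ℂ A]
    [TopologicalSpace A] (P : MaxA A) {a : A} (ha : a ∈ P.1) {U : Set A} (hU : U ∈ 𝓝 a) :
    ∀ᶠ R : MaxA A in 𝓝 P, ((R.1 : Set A) ∩ U).Nonempty := by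
  obtain ⟨V, hVU, hV, haV⟩ := mem_nhds_iff.mp hU
  have hopen : IsOpen {R : MaxA A | ((R.1 : Set A) ∩ V).Nonempty} :=
    TopologicalSpace.isOpen_generateFrom_of_mem ⟨V, hV, rfl⟩
  filter_upwards [hopen.mem_nhds ⟨a, ha, haV⟩] with R hR
  exact hR.mono (Set.inter_subset_inter_right _ hVU)

lemma mul_mem_maxMul {A : Type*} [NonUnitalCStarAlgebra A] {P Q : MaxA A} {a b : A}
    (ha : a ∈ P.1) (hb : b ∈ Q.1) : a * b ∈ (maxMul P Q).1 :=
  Submodule.le_topologicalClosure _ (Submodule.subset_span (Set.mul_mem_mul ha hb))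

open Topology Filter in
lemma eventually_maxMul_inter_nonempty {A : Type*} [NonUnitalCStarAlgebra A] (P Q : MaxA A)
    {x : A} (hx : x ∈ Submodule.span ℂ ((P.1 : Set A) * (Q.1 : Set A))) :
    ∀ U ∈ 𝓝 x, ∀ᶠ p : MaxA A × MaxA A in 𝓝 (P, Q),
      (((maxMul p.1 p.2).1 : Set A) ∩ U).Nonempty := by
  induction hx using Submodule.span_induction with
  | mem x hx =>
    obtain ⟨a, ha, b, hb, rfl⟩ := hx
    intro U hU
    obtain ⟨V, hV, W, hW, hVW⟩ := mem_nhds_prod_iff.mp (continuous_mul.continuousAt hU :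
      (fun q : A × A => q.1 * q.2) ⁻¹' U ∈ 𝓝 (a, b))
    rw [nhds_prod_eq]
    filter_upwards [(P.eventually_inter_nonempty ha hV).prod_mk
      (Q.eventually_inter_nonempty hb hW)]
    rintro p ⟨⟨c, hc, hcV⟩, d, hd, hdW⟩
    exact ⟨c * d, mul_mem_maxMul hc hd, hVW (Set.mk_mem_prod hcV hdW)⟩
  | zero =>
    intro U hU
    exact Eventually.of_forall fun p => ⟨0, zero_mem _, mem_of_mem_nhds hU⟩
  | add x y _ _ ihx ihy =>
    intro U hU
    obtain ⟨V, hV, W, hW, hVW⟩ := mem_nhds_prod_iff.mp (continuous_add.continuousAt hU :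
      (fun q : A × A => q.1 + q.2) ⁻¹' U ∈ 𝓝 (x, y))
    filter_upwards [ihx V hV, ihy W hW]
    rintro p ⟨c, hc, hcV⟩ ⟨d, hd, hdW⟩
    exact ⟨c + d, add_mem hc hd, hVW (Set.mk_mem_prod hcV hdW)⟩
  | smul t x _ ih =>
    intro U hU
    filter_upwards [ih _ ((continuous_const_smul t).continuousAt hU)]
    rintro p ⟨c, hc, hcU⟩
    exact ⟨t • c, Submodule.smul_mem _ t hc, hcU⟩

theorem stmt14 (A : Type*) [NonUnitalCStarAlgebra A] :
    Continuous (fun p : MaxA A × MaxA A => maxMul p.1 p.2) := by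
  refine continuous_generateFrom_iff.mpr ?_
  rintro _ ⟨U, hU, rfl⟩
  refine isOpen_iff_mem_nhds.mpr ?_
  rintro ⟨P, Q⟩ ⟨x, hx, hxU⟩
  obtain ⟨y, hyU, hy⟩ := mem_closure_iff.mp hx U hU hxU
  exact eventually_maxMul_inter_nonempty P Q hy U (hU.mem_nhds hyU)
end

section
/- Consider the C*-algebra ℂ², whose linear subspaces (all of which are closed) form Max ℂ², topologized with the lower Vietoris topology. Let α : Max ℂ² → Max ℂ² be the map defined by: α((z,w)ℂ) = (w,z)ℂ whenever z ≠ 0 and w ≠ 0; α((z,0)ℂ) = (z,0)ℂ; α((0,w)ℂ) = (0,w)ℂ; α({0}) = {0}; and α(ℂ²) = ℂ². Then α is not continuous with respect to the lower Vietoris topology; in particular, the sequence of lines (1/n, 1)ℂ does not converge to the line (1,0)ℂ in Max ℂ², even though α((1, 1/n)ℂ) = (1/n, 1)ℂ and (1, 1/n)ℂ converges to (1,0)ℂ. -/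
open Filter

/-- The line `vℂ` spanned by a vector `v ∈ ℂ²`, as an element of `Max ℂ²`. -/
noncomputable def line (v : ℂ × ℂ) : MaxA (ℂ × ℂ) :=
  ⟨Submodule.span ℂ ({v} : Set (ℂ × ℂ)),
    (Submodule.span ℂ ({v} : Set (ℂ × ℂ))).closed_of_finiteDimensional⟩

/-- The zero subspace `{0}` of `ℂ²`. -/
noncomputable def zeroSub : MaxA (ℂ × ℂ) :=
  ⟨(⊥ : Submodule ℂ (ℂ × ℂ)), (⊥ : Submodule ℂ (ℂ × ℂ)).closed_of_finiteDimensional⟩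

/-- The full subspace `ℂ²`. -/
noncomputable def fullSub : MaxA (ℂ × ℂ) :=
  ⟨(⊤ : Submodule ℂ (ℂ × ℂ)), (⊤ : Submodule ℂ (ℂ × ℂ)).closed_of_finiteDimensional⟩

/-- The subbasic open sets of the lower Vietoris topology are open. -/
theorem MaxA.isOpen_hit {A : Type*} [AddCommGroup A] [Module ℂ A] [TopologicalSpace A]
    {U : Set A} (hU : IsOpen U) :
    IsOpen {P : MaxA A | (((P.1 : Submodule ℂ A) : Set A) ∩ U).Nonempty} :=
  TopologicalSpace.isOpen_generateFrom_of_mem ⟨U, hU, rfl⟩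

theorem line_hit_iff (v : ℂ × ℂ) (U : Set (ℂ × ℂ)) :
    ((((line v).1 : Submodule ℂ (ℂ × ℂ)) : Set (ℂ × ℂ)) ∩ U).Nonempty ↔ ∃ c : ℂ, c • v ∈ U := by
  constructor
  · rintro ⟨x, hx, hxU⟩
    obtain ⟨c, rfl⟩ := Submodule.mem_span_singleton.1 hx
    exact ⟨c, hxU⟩
  · rintro ⟨c, hc⟩
    exact ⟨c • v, Submodule.mem_span_singleton.2 ⟨c, rfl⟩, hc⟩

theorem continuous_line : Continuous line := by
  refine continuous_generateFrom_iff.2 ?_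
  rintro _ ⟨U, hU, rfl⟩
  simp only [Set.preimage_ofPred_eq, line_hit_iff, Set.ofPred_exists]
  exact isOpen_iUnion fun c => hU.preimage (continuous_const_smul c)

theorem tendsto_line_one_inv :
    Tendsto (fun n : ℕ => line (1, (n : ℂ)⁻¹)) atTop (nhds (line (1, 0))) :=
  (continuous_line.tendsto (1, 0)).comp
    (tendsto_const_nhds.prodMk_nhds tendsto_inv_atTop_nhds_zero_nat)

theorem not_tendsto_line_inv_one :
    ¬ Tendsto (fun n : ℕ => line ((n : ℂ)⁻¹, 1)) atTop (nhds (line (1, 0))) := by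
  intro h
  have hU : IsOpen {p : ℂ × ℂ | ‖p.2‖ < ‖p.1‖} :=
    isOpen_lt continuous_snd.norm continuous_fst.norm
  have hmem : ∀ᶠ n : ℕ in atTop, ∃ c : ℂ, c • ((n : ℂ)⁻¹, (1 : ℂ)) ∈
      {p : ℂ × ℂ | ‖p.2‖ < ‖p.1‖} := by
    refine (h.eventually ((MaxA.isOpen_hit hU).mem_nhds ((line_hit_iff _ _).2 ⟨1, ?_⟩))).mono
      fun n hn => (line_hit_iff _ _).1 hn
    simp
  obtain ⟨n, c, hc⟩ := hmem.exists
  have hlt : ‖c‖ < ‖c‖ * (n : ℝ)⁻¹ := by simpa using hc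
  exact hlt.not_ge (mul_le_of_le_one_right (norm_nonneg c) n.cast_inv_le_one)

theorem stmt16 :
    -- `(1, 1/n)ℂ` converges to `(1,0)ℂ` in the lower Vietoris topology:
    Tendsto (fun n : ℕ => line (1, (n : ℂ)⁻¹)) atTop (nhds (line (1, 0))) ∧
    -- but `(1/n, 1)ℂ` does not converge to `(1,0)ℂ`:
    ¬ Tendsto (fun n : ℕ => line ((n : ℂ)⁻¹, 1)) atTop (nhds (line (1, 0))) ∧
    -- hence any map `α` as in the statement fails to be continuous:
    ∀ α : MaxA (ℂ × ℂ) → MaxA (ℂ × ℂ),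
      (∀ z w : ℂ, z ≠ 0 → w ≠ 0 → α (line (z, w)) = line (w, z)) →
      (∀ z : ℂ, α (line (z, 0)) = line (z, 0)) →
      (∀ w : ℂ, α (line (0, w)) = line (0, w)) →
      α zeroSub = zeroSub →
      α fullSub = fullSub →
      ¬ Continuous α := by
  refine ⟨tendsto_line_one_inv, not_tendsto_line_inv_one, ?_⟩
  intro α hswap hfst _ _ _ hα
  refine not_tendsto_line_inv_one ?_
  have h := (hα.tendsto (line (1, 0))).comp tendsto_line_one_inv
  rw [hfst] at h
  refine h.congr' ?_
  filter_upwards [eventually_ne_atTop 0] with n hn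
  exact hswap _ _ one_ne_zero (inv_ne_zero (Nat.cast_ne_zero.2 hn))
end

section
/- Let A be a commutative C*-algebra and let I(A) denote the set of closed ideals of A, partially ordered by inclusion (a complete lattice, in fact a frame, whose suprema are closures of sums). Then the lower Vietoris topology on I(A) — the topology generated by the sets {I ∈ I(A) : I ∩ U ≠ ∅} for U open in A — coincides with the Scott topology of the inclusion order on I(A). -/
/-- The closed (two-sided) ideals of a C*-algebra, ordered by inclusion. -/
def ClosedIdeals (A : Type*) [NonUnitalNormedRing A] :=
  {I : TwoSidedIdeal A // IsClosed (I : Set A)}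

instance (A : Type*) [NonUnitalNormedRing A] : PartialOrder (ClosedIdeals A) :=
  Subtype.partialOrder _

/-- The lower Vietoris topology on the closed ideals, generated by the sets
`{I : I ∩ U ≠ ∅}` for `U` open in `A`. -/
def lowerVietorisIdeals (A : Type*) [NonUnitalNormedRing A] :
    TopologicalSpace (ClosedIdeals A) :=
  TopologicalSpace.generateFrom
    {V : Set (ClosedIdeals A) | ∃ U : Set A, IsOpen U ∧
      V = {I : ClosedIdeals A | (((I.1 : TwoSidedIdeal A) : Set A) ∩ U).Nonempty}}

/-- The Scott topology of the inclusion order on the closed ideals. -/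
def scottIdeals (A : Type*) [NonUnitalNormedRing A] :
    TopologicalSpace (ClosedIdeals A) :=
  Topology.scott (ClosedIdeals A) Set.univ

section LowerVietorisScott

variable {A : Type*}

/-- The closure of a nonempty directed union of closed ideals. -/
def ClosedIdeals.directedSup [NonUnitalNormedRing A] (d : Set (ClosedIdeals A))
    (hne : d.Nonempty) (hd : DirectedOn (· ≤ ·) d) : ClosedIdeals A :=
  have hadd {x y : A} (hx : x ∈ closure (⋃ I ∈ d, (I.1 : Set A)))
      (hy : y ∈ closure (⋃ I ∈ d, (I.1 : Set A))) :
      x + y ∈ closure (⋃ I ∈ d, (I.1 : Set A)) := by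
    refine map_mem_closure₂ continuous_add hx hy fun a ha b hb => ?_
    simp only [Set.mem_iUnion, SetLike.mem_coe, exists_prop] at ha hb ⊢
    obtain ⟨I, hI, ha⟩ := ha
    obtain ⟨J, hJ, hb⟩ := hb
    obtain ⟨K, hK, hIK, hJK⟩ := hd I hI J hJ
    exact ⟨K, hK, K.1.add_mem (hIK ha) (hJK hb)⟩
  have hzero : (0 : A) ∈ closure (⋃ I ∈ d, (I.1 : Set A)) := by
    obtain ⟨I, hI⟩ := hne
    exact subset_closure (Set.mem_biUnion hI I.1.zero_mem)
  have hneg {x : A} (hx : x ∈ closure (⋃ I ∈ d, (I.1 : Set A))) :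
      -x ∈ closure (⋃ I ∈ d, (I.1 : Set A)) := by
    refine map_mem_closure continuous_neg hx fun a ha => ?_
    simp only [Set.mem_iUnion, SetLike.mem_coe, exists_prop] at ha ⊢
    obtain ⟨I, hI, ha⟩ := ha
    exact ⟨I, hI, I.1.neg_mem ha⟩
  have hleft {x y : A} (hy : y ∈ closure (⋃ I ∈ d, (I.1 : Set A))) :
      x * y ∈ closure (⋃ I ∈ d, (I.1 : Set A)) := by
    refine map_mem_closure (continuous_const_mul x) hy fun a ha => ?_
    simp only [Set.mem_iUnion, SetLike.mem_coe, exists_prop] at ha ⊢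
    obtain ⟨I, hI, ha⟩ := ha
    exact ⟨I, hI, I.1.mul_mem_left _ _ ha⟩
  have hright {x y : A} (hx : x ∈ closure (⋃ I ∈ d, (I.1 : Set A))) :
      x * y ∈ closure (⋃ I ∈ d, (I.1 : Set A)) := by
    refine map_mem_closure (f := (· * y)) (continuous_mul_const y) hx fun a ha => ?_
    simp only [Set.mem_iUnion, SetLike.mem_coe, exists_prop] at ha ⊢
    obtain ⟨I, hI, ha⟩ := ha
    exact ⟨I, hI, I.1.mul_mem_right _ _ ha⟩
  ⟨TwoSidedIdeal.mk' (closure (⋃ I ∈ d, (I.1 : Set A))) hzero hadd hneg hleft hright, by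
    rw [TwoSidedIdeal.coe_mk']
    exact isClosed_closure⟩

theorem ClosedIdeals.mem_directedSup [NonUnitalNormedRing A] {d : Set (ClosedIdeals A)}
    {hne : d.Nonempty} {hd : DirectedOn (· ≤ ·) d} {x : A} :
    x ∈ (directedSup d hne hd).1 ↔ x ∈ closure (⋃ I ∈ d, (I.1 : Set A)) := by
  rw [← SetLike.mem_coe, directedSup, TwoSidedIdeal.coe_mk']

/-- The closed ideal of all `x` with `f * x = x`. -/
def ClosedIdeals.fixedBy [NonUnitalNormedCommRing A] (f : A) : ClosedIdeals A :=
  ⟨TwoSidedIdeal.mk' {x | f * x = x} (mul_zero f)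
    (fun {x y} (hx : f * x = x) (hy : f * y = y) => show f * (x + y) = x + y by
      rw [mul_add, hx, hy])
    (fun {x} (hx : f * x = x) => show f * (-x) = -x by rw [mul_neg, hx])
    (fun {x y} (hy : f * y = y) => show f * (x * y) = x * y by rw [mul_left_comm, hy])
    (fun {x y} (hx : f * x = x) => show f * (x * y) = x * y by rw [← mul_assoc, hx]), by
    rw [TwoSidedIdeal.coe_mk']
    exact isClosed_eq (continuous_const_mul f) continuous_id⟩

theorem ClosedIdeals.mem_fixedBy [NonUnitalNormedCommRing A] {f x : A} :
    x ∈ (fixedBy f).1 ↔ f * x = x := by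
  rw [← SetLike.mem_coe, fixedBy, TwoSidedIdeal.coe_mk', Set.mem_ofPred_eq]

theorem ClosedIdeals.fixedBy_le_of_norm_sub_lt_one [NonUnitalNormedCommRing A] {f g : A}
    {K : ClosedIdeals A} (hg : g ∈ K.1) (hfg : ‖f - g‖ < 1) : fixedBy f ≤ K := by
  intro x hx
  rw [mem_fixedBy] at hx
  have approx (n : ℕ) : ∃ k ∈ K.1, ‖x - k‖ ≤ ‖f - g‖ ^ n * ‖x‖ := by
    induction n with
    | zero => exact ⟨0, K.1.zero_mem, by simp⟩
    | succ n ih =>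
      obtain ⟨k, hk, hxk⟩ := ih
      refine ⟨g * x + (f - g) * k,
        K.1.add_mem (K.1.mul_mem_right _ _ hg) (K.1.mul_mem_left _ _ hk), ?_⟩
      have : x - (g * x + (f - g) * k) = (f - g) * (x - k) := by
        rw [mul_sub, sub_mul f g x, hx]; abel
      rw [this, pow_succ', mul_assoc]
      exact (norm_mul_le _ _).trans (by gcongr)
  choose k hk hxk using approx
  refine K.2.mem_of_tendsto (f := k) (b := Filter.atTop) ?_ (Filter.Eventually.of_forall hk)
  rw [tendsto_iff_norm_sub_tendsto_zero]
  refine squeeze_zero (fun _ => norm_nonneg _)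
    (fun n => (norm_sub_rev _ _).le.trans (hxk n)) ?_
  simpa using (tendsto_pow_atTop_nhds_zero_of_lt_one (norm_nonneg _) hfg).mul_const ‖x‖

theorem ClosedIdeals.directedOn_fixedBy [NonUnitalNormedCommRing A] (I : ClosedIdeals A) :
    DirectedOn (· ≤ ·) (fixedBy '' (I.1 : Set A)) := by
  rintro _ ⟨f, hf, rfl⟩ _ ⟨g, hg, rfl⟩
  refine ⟨_, ⟨f + g - f * g,
    I.1.sub_mem (I.1.add_mem hf hg) (I.1.mul_mem_left _ _ hg), rfl⟩, ?_, ?_⟩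
  all_goals
    intro x hx
    rw [mem_fixedBy] at hx ⊢
  · rw [sub_mul, add_mul, mul_comm f g, mul_assoc, hx]; abel
  · rw [sub_mul, add_mul, mul_assoc, hx]; abel

/-- Every element of a commutative C*-algebra is approximated by multiples of itself that are
fixed by some other multiple of it. -/
theorem exists_mul_fixed_norm_sub_le [NonUnitalCommCStarAlgebra A] (h : A) {ε : ℝ} (hε : 0 < ε) :
    ∃ p q : A, h * q * (h * p) = h * p ∧ ‖h - h * p‖ ^ 2 ≤ ε := by
  set a : A := star h * h with ha_def
  have ha : IsSelfAdjoint a := IsSelfAdjoint.star_mul_self h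
  have hden (t : ℝ) : max (t ^ 2) (ε ^ 2) ≠ 0 := by positivity
  let k : ℝ → ℝ := fun t => t / max (t ^ 2) (ε ^ 2)
  let ψ : ℝ → ℝ := fun t => max 0 (t ^ 2 - ε ^ 2) / max (t ^ 2) (ε ^ 2)
  have hk : Continuous k := by fun_prop (disch := exact hden _)
  have hψ : Continuous ψ := by fun_prop (disch := exact hden _)
  have hk0 : k 0 = 0 := by simp [k]
  have hψ0 : ψ 0 = 0 := by
    simp only [ψ]
    rw [max_eq_left (by nlinarith), zero_div]
  have hkψ (t : ℝ) : t * k t * ψ t = ψ t := by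
    simp only [k, ψ]
    rcases le_total (t ^ 2) (ε ^ 2) with ht | ht
    · rw [max_eq_left (sub_nonpos.2 ht)]; simp
    · have : t ≠ 0 := by rintro rfl; nlinarith
      rw [max_eq_left ht]; field_simp
  have hsmall (t : ℝ) : ‖t - t * ψ t - (t * ψ t - t * ψ t * ψ t)‖ ≤ ε := by
    have hfac : t - t * ψ t - (t * ψ t - t * ψ t * ψ t) = t * (1 - ψ t) ^ 2 := by ring
    rw [hfac, Real.norm_eq_abs, abs_mul, abs_of_nonneg (sq_nonneg (1 - ψ t))]
    simp only [ψ]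
    rcases le_total (t ^ 2) (ε ^ 2) with ht | ht
    · rw [max_eq_left (sub_nonpos.2 ht)]
      simpa using abs_le_of_sq_le_sq ht hε.le
    · have hεt : ε ≤ |t| := by simpa [abs_of_pos hε] using sq_le_sq.1 ht
      have ht0 : 0 < |t| := hε.trans_le hεt
      rw [max_eq_left ht, max_eq_right (sub_nonneg.2 ht), ← sq_abs t]
      have : 1 - (|t| ^ 2 - ε ^ 2) / |t| ^ 2 = (ε / |t|) ^ 2 := by field_simp; ring
      rw [this]
      have h1 : ε / |t| ≤ 1 := (div_le_one ht0).2 hεt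
      have h0 : 0 ≤ ε / |t| := by positivity
      calc |t| * ((ε / |t|) ^ 2) ^ 2 = ε * (ε / |t|) ^ 3 := by field_simp
        _ ≤ ε * 1 := by gcongr; exact pow_le_one₀ h0 h1
        _ = ε := mul_one ε
  let p : A := cfcₙ ψ a
  have hp : star p = p := (cfcₙ_predicate ψ a : IsSelfAdjoint p)
  have hid : cfcₙ (fun t : ℝ => t) a = a := cfcₙ_id' ℝ a
  have hap : cfcₙ (fun t => t * ψ t) a = a * p := by
    rw [cfcₙ_mul (fun t => t) ψ a (by fun_prop) rfl (by fun_prop) hψ0, hid]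
  have happ : cfcₙ (fun t => t * ψ t * ψ t) a = a * p * p := by
    rw [cfcₙ_mul (fun t => t * ψ t) ψ a (by fun_prop) (by simp) (by fun_prop) hψ0, hap]
  have hfix : a * cfcₙ k a * p = p := by
    have := cfcₙ_mul (fun t => t * k t) ψ a (by fun_prop) (by simp) (by fun_prop) hψ0
    rw [cfcₙ_mul (fun t => t) k a (by fun_prop) rfl (by fun_prop) hk0, hid] at this
    rw [← this]
    simp only [hkψ, p]
  refine ⟨p, star h * cfcₙ k a, ?_, ?_⟩
  · calc h * (star h * cfcₙ k a) * (h * p) = h * (a * cfcₙ k a * p) := by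
          rw [ha_def]; ac_rfl
      _ = h * p := by rw [hfix]
  · rw [sq, ← CStarRing.norm_star_mul_self]
    have : star (h - h * p) * (h - h * p)
        = cfcₙ (fun t => t - t * ψ t - (t * ψ t - t * ψ t * ψ t)) a := by
      rw [cfcₙ_sub (fun t => t - t * ψ t) (fun t => t * ψ t - t * ψ t * ψ t) a
          (by fun_prop) (by simp) (by fun_prop) (by simp),
        cfcₙ_sub (fun t => t) (fun t => t * ψ t) a (by fun_prop) rfl (by fun_prop) (by simp),
        cfcₙ_sub (fun t => t * ψ t) (fun t => t * ψ t * ψ t) a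
          (by fun_prop) (by simp) (by fun_prop) (by simp), hid, hap, happ, star_sub, star_mul, hp,
        sub_mul, mul_sub, mul_sub, ha_def]
      congr 2
      · ac_rfl
      · ac_rfl
      · ac_rfl
    rw [this]
    exact norm_cfcₙ_le fun t _ => hsmall t

theorem ClosedIdeals.isLUB_fixedBy [NonUnitalCommCStarAlgebra A] (I : ClosedIdeals A) :
    IsLUB (fixedBy '' (I.1 : Set A)) I := by
  constructor
  · rintro _ ⟨f, hf, rfl⟩
    exact fixedBy_le_of_norm_sub_lt_one hf (by simp)
  · intro K hK h hh
    refine K.2.closure_subset (Metric.mem_closure_iff.2 fun ε hε => ?_)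
    obtain ⟨p, q, hfix, hnorm⟩ := exists_mul_fixed_norm_sub_le h (ε := (ε / 2) ^ 2) (by positivity)
    refine ⟨h * p, hK ⟨h * q, I.1.mul_mem_right _ _ hh, rfl⟩ (mem_fixedBy.2 hfix), ?_⟩
    rw [dist_eq_norm]
    exact (le_of_sq_le_sq hnorm (by positivity)).trans_lt (half_lt_self hε)

end LowerVietorisScott

theorem stmt18 (A : Type*) [NonUnitalCommCStarAlgebra A] :
    lowerVietorisIdeals A = scottIdeals A := by
  let : TopologicalSpace (ClosedIdeals A) := scottIdeals A
  have : Topology.IsScott (ClosedIdeals A) Set.univ := ⟨rfl⟩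
  apply le_antisymm
  · intro 𝒰 h𝒰
    obtain ⟨hupper, hinacc⟩ := (Topology.IsScott.isOpen_iff_isUpperSet_and_dirSupInaccOn
      (D := Set.univ)).1 h𝒰
    refine (@isOpen_iff_forall_mem_open _ (lowerVietorisIdeals A) 𝒰).2 fun I hI => ?_
    obtain ⟨_, ⟨f, hf, rfl⟩, hf𝒰⟩ := hinacc (Set.mem_univ _)
      (⟨_, 0, I.1.zero_mem, rfl⟩ : (ClosedIdeals.fixedBy '' (I.1 : Set A)).Nonempty)
      I.directedOn_fixedBy I.isLUB_fixedBy hI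
    refine ⟨{K | ((K.1 : Set A) ∩ Metric.ball f 1).Nonempty}, ?_,
      TopologicalSpace.isOpen_generateFrom_of_mem ⟨_, Metric.isOpen_ball, rfl⟩,
      ⟨f, hf, Metric.mem_ball_self one_pos⟩⟩
    rintro K ⟨g, hg, hgf⟩
    rw [Metric.mem_ball', dist_eq_norm] at hgf
    exact hupper (ClosedIdeals.fixedBy_le_of_norm_sub_lt_one hg hgf) hf𝒰
  · refine le_generateFrom ?_
    rintro _ ⟨U, hU, rfl⟩
    refine (Topology.IsScott.isOpen_iff_isUpperSet_and_dirSupInaccOn (D := Set.univ)).2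
      ⟨fun I J hIJ hI => hI.mono (Set.inter_subset_inter_left U hIJ), ?_⟩
    rintro d - hne hd I hI ⟨x, hx, hxU⟩
    have hIle : I ≤ ClosedIdeals.directedSup d hne hd := hI.2 fun J hJ y hy =>
      ClosedIdeals.mem_directedSup.2 (subset_closure (Set.mem_biUnion hJ hy))
    obtain ⟨y, hyU, hy⟩ := mem_closure_iff.1 (ClosedIdeals.mem_directedSup.1 (hIle hx)) U hU hxU
    obtain ⟨J, hJ, hyJ⟩ := Set.mem_iUnion₂.1 hy
    exact ⟨J, hJ, y, hyJ, hyU⟩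
end

section
/- Let X be a locally compact Hausdorff space. The open-support map osupp : C₀(X, ℂ) → O(X), defined by osupp(f) = {x ∈ X : f(x) ≠ 0}, is continuous from C₀(X, ℂ) with its supremum-norm topology to the lattice O(X) of open subsets of X equipped with the Scott topology; moreover osupp is sup-linear, i.e. osupp(0) = ∅ and osupp(λf + g) ⊆ osupp(f) ∪ osupp(g) for all f, g ∈ C₀(X, ℂ) and λ ∈ ℂ. -/
open ZeroAtInfty TopologicalSpace

/-- The open support of a function `f ∈ C₀(X, ℂ)`: the open set `{x : f x ≠ 0}`. -/
def osupp {X : Type*} [TopologicalSpace X] (f : C₀(X, ℂ)) : Opens X :=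
  ⟨{x | f x ≠ 0}, by
    have h : {x | f x ≠ 0} = (f : X → ℂ) ⁻¹' ({(0 : ℂ)}ᶜ) := rfl
    rw [h]
    exact isOpen_compl_singleton.preimage f.continuous⟩

/-- The open set on which `‖f‖` exceeds `ε`. -/
def normSuperlevel {X : Type*} [TopologicalSpace X] (f : C₀(X, ℂ)) (ε : ℝ) : Opens X :=
  ⟨{x | ε < ‖f x‖}, isOpen_lt continuous_const f.continuous.norm⟩

theorem normSuperlevel_antitone {X : Type*} [TopologicalSpace X] (f : C₀(X, ℂ)) :
    Antitone (normSuperlevel f) :=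
  fun _ _ h _ hx => lt_of_le_of_lt h hx

theorem isLUB_normSuperlevel {X : Type*} [TopologicalSpace X] (f : C₀(X, ℂ)) :
    IsLUB (normSuperlevel f '' Set.Ioi 0) (osupp f) := by
  constructor
  · rintro _ ⟨ε, hε, rfl⟩ x hx
    exact norm_pos_iff.1 (lt_trans hε hx)
  · intro W hW x hx
    have hpos : 0 < ‖f x‖ := norm_pos_iff.2 hx
    exact hW ⟨‖f x‖ / 2, half_pos hpos, rfl⟩ (half_lt_self hpos)

theorem normSuperlevel_le_osupp {X : Type*} [TopologicalSpace X] {f g : C₀(X, ℂ)} {ε : ℝ}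
    (h : dist g f < ε) : normSuperlevel f ε ≤ osupp g := by
  intro x hx hgx
  have hle : dist (g x) (f x) ≤ dist g f :=
    BoundedContinuousFunction.dist_coe_le_dist (f := g.toBCF) (g := f.toBCF) x
  rw [hgx, dist_zero_left] at hle
  exact absurd (hle.trans_lt h) (not_lt.2 (le_of_lt hx))

theorem continuous_osupp (X : Type*) [TopologicalSpace X] :
    @Continuous C₀(X, ℂ) (Opens X) _ (Topology.scott (Opens X) Set.univ) osupp := by
  let := Topology.scott (Opens X) Set.univ
  have : Topology.IsScott (Opens X) Set.univ := ⟨rfl⟩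
  refine continuous_def.2 fun U hU => Metric.isOpen_iff.2 fun f hf => ?_
  obtain ⟨hup, hinacc⟩ :=
    (Topology.IsScott.isOpen_iff_isUpperSet_and_dirSupInaccOn (D := Set.univ)).1 hU
  have hdir : DirectedOn (· ≤ ·) (normSuperlevel f '' Set.Ioi 0) := by
    rintro _ ⟨a, ha, rfl⟩ _ ⟨b, hb, rfl⟩
    exact ⟨_, ⟨min a b, Set.mem_Ioi.2 (lt_min ha hb), rfl⟩, normSuperlevel_antitone f (min_le_left a b),
      normSuperlevel_antitone f (min_le_right a b)⟩
  obtain ⟨_, ⟨ε, hε, rfl⟩, hεU⟩ := hinacc (Set.mem_univ _)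
    (Set.Nonempty.image _ ⟨1, one_pos⟩) hdir (isLUB_normSuperlevel f) hf
  exact ⟨ε, hε, fun g hg => hup (normSuperlevel_le_osupp hg) hεU⟩

theorem osupp_zero (X : Type*) [TopologicalSpace X] : osupp (0 : C₀(X, ℂ)) = ⊥ :=
  le_bot_iff.1 fun _ hx => hx rfl

theorem osupp_smul_add_le {X : Type*} [TopologicalSpace X] (f g : C₀(X, ℂ)) (c : ℂ) :
    osupp (c • f + g) ≤ osupp f ⊔ osupp g := by
  intro x hx
  by_contra hfg
  obtain ⟨hf, hg⟩ := not_or.1 hfg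
  refine hx ?_
  have hf' : f x = 0 := not_not.1 hf
  have hg' : g x = 0 := not_not.1 hg
  simp [hf', hg']

theorem stmt19 (X : Type*) [TopologicalSpace X] [LocallyCompactSpace X] [T2Space X] :
    -- `osupp` is continuous from the norm topology to the Scott topology on `O(X)`
    @Continuous C₀(X, ℂ) (Opens X) _ (Topology.scott (Opens X) Set.univ)
      (osupp : C₀(X, ℂ) → Opens X) ∧
    -- `osupp` is sup-linear
    osupp (0 : C₀(X, ℂ)) = ⊥ ∧
    (∀ (f g : C₀(X, ℂ)) (c : ℂ), osupp (c • f + g) ≤ osupp f ⊔ osupp g) :=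
  ⟨continuous_osupp X, osupp_zero X, osupp_smul_add_le⟩
end
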